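/- Let R be a commutative ring, I an ideal of R, M an R-module, and P an I-primary submodule of M such that IP ⊆ (P : M)²P (i.e. I•P is contained in the submodule (P : M)•((P : M)•P)). If P is not a primary submodule of M, then IP = (P : M)²P. -/

import Mathlib

/-- `P` is an `I`-primary submodule of `M`. -/
def IsIPrimary {R : Type*} [CommRing R] {M : Type*} [AddCommGroup M] [Module R M]
    (I : Ideal R) (P : Submodule R M) : Prop :=
  P ≠ ⊤ ∧ ∀ r : R, ∀ m : M, r • m ∈ P → r • m ∉ I • P →
    m ∈ P ∨ r ∈ (P.colon ⊤).radical

/-- `P` is a primary submodule of `M`. -/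
def IsPrimarySubmodule {R : Type*} [CommRing R] {M : Type*} [AddCommGroup M] [Module R M]
    (P : Submodule R M) : Prop :=
  P ≠ ⊤ ∧ ∀ r : R, ∀ m : M, r • m ∈ P →
    m ∈ P ∨ r ∈ (P.colon ⊤).radical

theorem stmt1 {R : Type*} [CommRing R] {M : Type*} [AddCommGroup M] [Module R M]
    (I : Ideal R) (P : Submodule R M)
    (hP : IsIPrimary I P)
    (h : I • P ≤ P.colon ⊤ • (P.colon ⊤ • P))
    (hnp : ¬ IsPrimarySubmodule P) :
    I • P = P.colon ⊤ • (P.colon ⊤ • P) := by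
  obtain ⟨hne, hI⟩ := hP
  have hex : ∃ r : R, ∃ m : M, r • m ∈ P ∧ m ∉ P ∧ r ∉ (P.colon ⊤).radical := by
    by_contra hcon
    refine hnp ⟨hne, fun r m hrm => ?_⟩
    by_contra hc
    rw [not_or] at hc
    exact hcon ⟨r, m, hrm, hc.1, hc.2⟩
  obtain ⟨r, m, hrm, hm, hr⟩ := hex
  have key : ∀ a ∈ P.colon ⊤, ∀ p ∈ P, (r + a) • (m + p) ∈ I • P := by
    intro a ha p hp
    by_contra hc
    have ham : a • m ∈ P := Submodule.mem_colon.mp ha m trivial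
    have hmem : (r + a) • (m + p) ∈ P := by
      rw [smul_add, add_smul]
      exact P.add_mem (P.add_mem hrm ham) (P.smul_mem _ hp)
    rcases hI _ _ hmem hc with h1 | h1
    · exact hm ((P.add_mem_iff_left hp).mp h1)
    · exact hr ((Submodule.add_mem_iff_left _ (Ideal.le_radical ha)).mp h1)
  refine le_antisymm h (Submodule.smul_le_right.trans (Submodule.smul_le.mpr ?_))
  intro a ha p hp
  have h1 := key a ha p hp
  have h2 := key a ha 0 P.zero_mem
  have h3 := key 0 (Submodule.zero_mem _) p hp
  have h4 := key 0 (Submodule.zero_mem _) 0 P.zero_mem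
  have e : a • p = (r + a) • (m + p) - (r + a) • (m + 0)
      - ((r + 0) • (m + p) - (r + 0) • (m + 0)) := by
    module
  rw [e]
  exact Submodule.sub_mem _ (Submodule.sub_mem _ h1 h2) (Submodule.sub_mem _ h3 h4)
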